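/- Let G be a nontrivial finite abelian group, n ≥ 1, and let (σ,ρ) and (τ,π) be double partitions of n with |σ| = |τ|. Then (σ,ρ) ≽_G (τ,π) if and only if σ ⊴ τ and ρ ⊴ π. -/

import Mathlib

/-- The monoid hom `Perm (Fin n) →* MulAut (Fin n → G)`, permuting coordinates. -/
def permMulAut (G : Type*) [CommGroup G] (n : ℕ) :
    Equiv.Perm (Fin n) →* MulAut (Fin n → G) where
  toFun π := MulEquiv.arrowCongr π (MulEquiv.refl G)
  map_one' := by ext f a; rfl
  map_mul' := by intro π σ; ext f a; rfl

/-- The wreath product `G ≀ Sₙ`. -/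
abbrev Wr (G : Type*) [CommGroup G] (n : ℕ) :=
  SemidirectProduct (Fin n → G) (Equiv.Perm (Fin n)) (permMulAut G n)

/-- The natural action of `G ≀ Sₙ` on `G × [n]`. -/
def wAct {G : Type*} [CommGroup G] {n : ℕ} (w : Wr G n) (p : G × Fin n) : G × Fin n :=
  (p.1 * w.left (w.right p.2), w.right p.2)

/-- The `i`-th largest part of a multiset of naturals (0-indexed; `0` beyond the last part). -/
def dparts (s : Multiset ℕ) (i : ℕ) : ℕ := ((s.sort (· ≤ ·)).reverse).getD i 0

/-- `s` is dominated by `t`. -/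
def msDom (s t : Multiset ℕ) : Prop :=
  ∀ k, (((s.sort (· ≤ ·)).reverse).take k).sum ≤ (((t.sort (· ≤ ·)).reverse).take k).sum

/-- `T` is a `(σ,ρ)`-tabloid: the first component assigns to each element of `[n]` a block
(`Sum.inl i` is the block of the `i+1`-st largest part of `σ`, `Sum.inr j` that of `ρ`),
blocks have the prescribed sizes, and the colouring (second component)
is normalised to `1` on the `ρ`-blocks. -/
def IsTabloid (G : Type*) [CommGroup G] (n : ℕ) (σ ρ : Multiset ℕ)
    (T : (Fin n → ℕ ⊕ ℕ) × (Fin n → G)) : Prop :=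
  (∀ i, Nat.card {a : Fin n // T.1 a = Sum.inl i} = dparts σ i) ∧
  (∀ j, Nat.card {a : Fin n // T.1 a = Sum.inr j} = dparts ρ j) ∧
  (∀ a j, T.1 a = Sum.inr j → T.2 a = 1)

/-- The action of the wreath product on (raw) tabloids. -/
def tabAct {G : Type*} [CommGroup G] {n : ℕ} (w : Wr G n)
    (T : (Fin n → ℕ ⊕ ℕ) × (Fin n → G)) : (Fin n → ℕ ⊕ ℕ) × (Fin n → G) :=
  ⟨fun a => T.1 (w.right⁻¹ a),
   fun a => match T.1 (w.right⁻¹ a) with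
     | Sum.inl _ => T.2 (w.right⁻¹ a) * w.left a
     | Sum.inr _ => 1⟩

/-- A subset `Y` of `W` is transitive on `S ⊆ Ω` (w.r.t. an action `act`): there is a
constant `c > 0` such that any `a ∈ S` is mapped to any `b ∈ S` by exactly `c` elements of `Y`. -/
def IsTransitiveOn {W Ω : Type*} (act : W → Ω → Ω) (S : Set Ω) (Y : Set W) : Prop :=
  ∃ c : ℕ, 0 < c ∧ ∀ a ∈ S, ∀ b ∈ S, Nat.card {y : W // y ∈ Y ∧ act y a = b} = c

/-- `Y ⊆ G ≀ Sₙ` is `(σ,ρ)`-transitive. -/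
def DPTransitive (G : Type*) [CommGroup G] (n : ℕ) (σ ρ : Multiset ℕ)
    (Y : Set (Wr G n)) : Prop :=
  IsTransitiveOn tabAct {T | IsTabloid G n σ ρ T} Y

/-- `(σ,ρ) ≽_G (τ,π)` : every `(σ,ρ)`-transitive subset of `G ≀ Sₙ` is `(τ,π)`-transitive. -/
def DPDom (G : Type*) [CommGroup G] (n : ℕ) (σ ρ τ π : Multiset ℕ) : Prop :=
  ∀ Y : Set (Wr G n), DPTransitive G n σ ρ Y → DPTransitive G n τ π Y

/-- The partition obtained by adding `k` to the `r`-th largest part (1-indexed). -/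
def addPart (s : Multiset ℕ) (r k : ℕ) : Multiset ℕ :=
  s.erase (dparts s (r - 1)) + {dparts s (r - 1) + k}

/-- The operator summing `v` over all ways to relabel one point from `J` to `I`. -/
def mvOp {n : ℕ} {L : Type} [DecidableEq L] (I J : L) (v : (Fin n → L) → ℤ)
    (A : Fin n → L) : ℤ :=
  ∑ x, if A x = J then v (Function.update A x I) else 0

theorem mvOp_adj {n : ℕ} {L : Type} [Fintype L] [DecidableEq L] (I J : L)
    (v w : (Fin n → L) → ℤ) :
    ∑ A, mvOp I J v A * w A = ∑ A, v A * mvOp J I w A := by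
  simp only [mvOp, Finset.sum_mul, Finset.mul_sum]
  rw [Finset.sum_comm]
  conv_rhs => rw [Finset.sum_comm]
  refine Finset.sum_congr rfl fun x _ => ?_
  simp only [ite_mul, mul_ite, zero_mul, mul_zero]
  rw [← Finset.sum_filter, ← Finset.sum_filter]
  refine Finset.sum_bij' (fun A _ => Function.update A x I) (fun A _ => Function.update A x J)
    ?_ ?_ ?_ ?_ ?_
  · intro A hA; simp
  · intro A hA; simp
  · intro A hA
    simp only [Finset.mem_filter, Finset.mem_univ, true_and] at hA
    simp [← hA]
  · intro A hA
    simp only [Finset.mem_filter, Finset.mem_univ, true_and] at hA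
    simp [← hA]
  · intro A hA
    simp only [Finset.mem_filter, Finset.mem_univ, true_and] at hA
    simp [← hA]

theorem mvOp_mvOp {n : ℕ} {L : Type} [DecidableEq L] (I J : L) (hIJ : I ≠ J)
    (v : (Fin n → L) → ℤ) (A : Fin n → L) :
    mvOp J I (mvOp I J v) A = ((Finset.univ.filter fun x => A x = I).card : ℤ) * v A +
      ∑ x, ∑ z, if A x = I ∧ A z = J then
        v (Function.update (Function.update A x J) z I) else 0 := by
  have h : ∀ x, (if A x = I then mvOp I J v (Function.update A x J) else 0) =
      (if A x = I then v A else 0) + ∑ z, if A x = I ∧ A z = J then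
        v (Function.update (Function.update A x J) z I) else 0 := by
    intro x
    by_cases hx : A x = I
    · simp only [hx, if_true, true_and, mvOp]
      rw [← Finset.add_sum_erase _ _ (Finset.mem_univ x)]
      rw [← Finset.add_sum_erase (a := x) (f := fun z => if A z = J then _ else _) _
        (Finset.mem_univ x)]
      simp only [Function.update_self, if_true, hx, hIJ, if_false, zero_add]
      congr 1
      · simp [← hx]
      · refine Finset.sum_congr rfl fun z hz => ?_
        rw [Function.update_of_ne (Finset.ne_of_mem_erase hz)]
    · simp [hx]
  unfold mvOp at h ⊢
  simp only [h, Finset.sum_add_distrib]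
  congr 1
  rw [← Finset.sum_filter]
  simp

theorem mvOp_comm {n : ℕ} {L : Type} [DecidableEq L] (I J : L) (hIJ : I ≠ J)
    (v : (Fin n → L) → ℤ) (A : Fin n → L) :
    mvOp J I (mvOp I J v) A = mvOp I J (mvOp J I v) A +
      (((Finset.univ.filter fun x => A x = I).card : ℤ) -
        ((Finset.univ.filter fun x => A x = J).card : ℤ)) * v A := by
  rw [mvOp_mvOp I J hIJ, mvOp_mvOp J I hIJ.symm, Finset.sum_comm]
  have : ∀ z x, (if A x = I ∧ A z = J then
        v (Function.update (Function.update A x J) z I) else 0) =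
      (if A z = J ∧ A x = I then
        v (Function.update (Function.update A z I) x J) else 0) := by
    intro z x
    by_cases h : A x = I ∧ A z = J
    · rw [if_pos h, if_pos h.symm, Function.update_comm]
      rintro rfl
      exact hIJ (h.1.symm.trans h.2)
    · rw [if_neg h, if_neg fun h' => h h'.symm]
  simp only [this]
  ring

theorem mvOp_inj {n : ℕ} {L : Type} [Fintype L] [DecidableEq L] (I J : L) (hIJ : I ≠ J)
    (v : (Fin n → L) → ℤ)
    (hs : ∀ A, v A ≠ 0 → (Finset.univ.filter fun x => A x = J).card <
      (Finset.univ.filter fun x => A x = I).card)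
    (hu : ∀ A, mvOp I J v A = 0) : ∀ A, v A = 0 := by
  have h1 := mvOp_adj J I (mvOp J I v) v
  have h2 : ∑ A, v A * mvOp J I (mvOp I J v) A = 0 := by
    have : mvOp I J v = fun _ => 0 := funext hu
    rw [this]; simp [mvOp]
  have h3 := mvOp_adj I J (mvOp J I v) v
  simp only [mvOp_comm I J hIJ, mul_add, Finset.sum_add_distrib] at h2
  have h4 : ∑ A, v A * mvOp I J (mvOp J I v) A = ∑ A, mvOp J I v A * mvOp J I v A := by
    rw [← h3]; exact Finset.sum_congr rfl fun A _ => mul_comm _ _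
  rw [h4] at h2
  have h5 : 0 ≤ ∑ A, mvOp J I v A * mvOp J I v A :=
    Finset.sum_nonneg fun A _ => mul_self_nonneg _
  have h6 : ∀ A ∈ Finset.univ, 0 ≤ v A * ((((Finset.univ.filter fun x => A x = I).card : ℤ) -
        ((Finset.univ.filter fun x => A x = J).card : ℤ)) * v A) := by
    intro A _
    by_cases hA : v A = 0
    · simp [hA]
    · have := hs A hA
      have h7 : (0:ℤ) ≤ ((Finset.univ.filter fun x => A x = I).card : ℤ) -
        ((Finset.univ.filter fun x => A x = J).card : ℤ) := by omega
      nlinarith [mul_nonneg h7 (mul_self_nonneg (v A))]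
  have h8 := (Finset.sum_eq_zero_iff_of_nonneg h6).1
    (le_antisymm (by linarith) (Finset.sum_nonneg h6))
  intro A
  by_contra hA
  have := h8 A (Finset.mem_univ A)
  have h9 := hs A hA
  rcases mul_eq_zero.1 this with h | h
  · exact hA h
  · rcases mul_eq_zero.1 h with h | h
    · omega
    · exact hA h

/-- Chain lemma: dominance is generated by moving single boxes upwards. -/
theorem dom_chain (P : (ℕ → ℕ) → Prop)
    (hstep : ∀ s i j, i < j → 1 ≤ s j → s j ≤ s i → P s →
      P (Function.update (Function.update s i (s i + 1)) j (s j - 1)))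
    (t : ℕ → ℕ) (ht : Antitone t) (N : ℕ) :
    ∀ m (s : ℕ → ℕ), Antitone s →
      (∀ k, ∑ i ∈ Finset.range k, s i ≤ ∑ i ∈ Finset.range k, t i) →
      (∀ k, N ≤ k → ∑ i ∈ Finset.range k, s i = ∑ i ∈ Finset.range k, t i) →
      (∑ k ∈ Finset.range N, ∑ i ∈ Finset.range k, t i ≤
        m + ∑ k ∈ Finset.range N, ∑ i ∈ Finset.range k, s i) → P s → P t := by
  classical
  intro m
  induction m with
  | zero =>
    intro s hs hd he hm hP
    have h1 := (Finset.sum_eq_sum_iff_of_le (s := Finset.range N) fun k _ => hd k).1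
      (le_antisymm (Finset.sum_le_sum fun k _ => hd k) (by omega))
    have h2 : ∀ k, ∑ i ∈ Finset.range k, s i = ∑ i ∈ Finset.range k, t i := by
      intro k
      by_cases hk : k < N
      · exact h1 k (Finset.mem_range.2 hk)
      · exact he k (by omega)
    have : s = t := by
      funext k
      have a := h2 k
      have b := h2 (k+1)
      rw [Finset.sum_range_succ, Finset.sum_range_succ] at b
      omega
    exact this ▸ hP
  | succ m ih =>
    intro s hs hd he hm hP
    by_cases hst : s = t
    · exact hst ▸ hP
    have hex : ∃ i, s i ≠ t i := by
      by_contra h; push Not at h; exact hst (funext h)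
    let i := Nat.find hex
    have hi : s i ≠ t i := Nat.find_spec hex
    have hlt : ∀ k < i, s k = t k := fun k hk => not_not.1 (Nat.find_min hex hk)
    have hPi : ∑ k ∈ Finset.range i, s k = ∑ k ∈ Finset.range i, t k :=
      Finset.sum_congr rfl fun k hk => hlt k (Finset.mem_range.1 hk)
    have hi' : s i < t i := by
      have := hd (i+1)
      rw [Finset.sum_range_succ, Finset.sum_range_succ] at this
      omega
    have hex2 : ∃ j, i < j ∧ ∑ k ∈ Finset.range (j+1), s k = ∑ k ∈ Finset.range (j+1), t k :=
      ⟨N + i + 1, by omega, he _ (by omega)⟩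
    let j := Nat.find hex2
    obtain ⟨hij, hj⟩ : i < j ∧ ∑ k ∈ Finset.range (j+1), s k = ∑ k ∈ Finset.range (j+1), t k :=
      Nat.find_spec hex2
    have hmid : ∀ k, i < k → k ≤ j →
        ∑ l ∈ Finset.range k, s l < ∑ l ∈ Finset.range k, t l := by
      intro k h1 h2
      refine lt_of_le_of_ne (hd k) fun h => ?_
      obtain rfl | hk : k = i + 1 ∨ i + 1 < k := by omega
      · rw [Finset.sum_range_succ, Finset.sum_range_succ] at h
        omega
      · refine Nat.find_min hex2 (m := k - 1) (by change k - 1 < j; omega) ⟨by omega, ?_⟩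
        have : k - 1 + 1 = k := by omega
        rw [this]; exact h
    have hjN : i < N := by
      by_contra h
      have := he (i+1) (by omega)
      have := hmid (i+1) (by omega) (by omega)
      omega
    have hi1N : i + 1 < N := by
      by_contra h
      have := he (i+1) (by omega)
      have := hmid (i+1) (by omega) (by omega)
      omega
    have hsj : t j < s j := by
      have := hmid j hij le_rfl
      rw [Finset.sum_range_succ, Finset.sum_range_succ] at hj
      omega
    have hsj1 : s (j+1) ≤ t (j+1) := by
      have := hd (j+1+1)
      rw [Finset.sum_range_succ, Finset.sum_range_succ (fun x => t x)] at this
      omega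
    have htj1 : t (j+1) ≤ t j := ht (by omega)
    let s' := Function.update (Function.update s i (s i + 1)) j (s j - 1)
    have hs'i : s' i = s i + 1 := by simp [s', hij.ne]
    have hs'j : s' j = s j - 1 := by simp [s']
    have hs'o : ∀ k, k ≠ i → k ≠ j → s' k = s k := fun k h1 h2 => by simp [s', h1, h2]
    have hsum : ∀ k, ∑ l ∈ Finset.range k, s' l =
        (∑ l ∈ Finset.range k, s l) + if i < k ∧ k ≤ j then 1 else 0 := by
      intro k
      induction k with
      | zero => simp
      | succ k ihk =>
        rw [Finset.sum_range_succ, ihk, Finset.sum_range_succ]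
        by_cases h1 : k = i
        · subst h1
          rw [hs'i]
          split_ifs <;> omega
        by_cases h2 : k = j
        · subst h2
          rw [hs'j]
          split_ifs <;> omega
        rw [hs'o k h1 h2]
        split_ifs <;> omega
    refine ih s' ?_ ?_ ?_ ?_ (hstep s i j hij (by omega) (hs hij.le) hP)
    · refine antitone_nat_of_succ_le fun k => ?_
      have hk := hs (Nat.le_succ k)
      simp only [Nat.succ_eq_add_one] at hk
      by_cases h1 : k = i
      · subst h1
        rw [hs'i]
        by_cases h2 : i + 1 = j
        · rw [h2, hs'j]; rw [h2] at hk; omega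
        · rw [hs'o _ (by omega) h2]; omega
      by_cases h2 : k = j
      · subst h2
        rw [hs'j, hs'o _ (by omega) (by omega)]; omega
      rw [hs'o k h1 h2]
      by_cases h3 : k + 1 = i
      · rw [h3, hs'i]
        have := hlt k (by omega)
        have := ht (show k ≤ i by omega)
        omega
      by_cases h4 : k + 1 = j
      · rw [h4, hs'j]; rw [h4] at hk; omega
      rw [hs'o _ h3 h4]; exact hk
    · intro k
      rw [hsum]
      split_ifs with h
      · exact hmid k h.1 h.2
      · exact hd k
    · intro k hk
      rw [hsum, if_neg, he k hk, add_zero]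
      intro h
      have := hmid k h.1 h.2
      have := he k hk
      omega
    · have : ∑ k ∈ Finset.range N, ∑ l ∈ Finset.range k, s l + 1 ≤
          ∑ k ∈ Finset.range N, ∑ l ∈ Finset.range k, s' l := by
        refine Nat.succ_le_of_lt (Finset.sum_lt_sum (fun k _ => ?_)
          ⟨i+1, Finset.mem_range.2 hi1N, ?_⟩)
        · rw [hsum]; omega
        · rw [hsum, if_pos ⟨by omega, by omega⟩]; omega
      omega

theorem dparts_eq (s : Multiset ℕ) (k : ℕ) :
    (((s.sort (· ≤ ·)).reverse).take k).sum = ∑ i ∈ Finset.range k, dparts s i := by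
  unfold dparts
  induction ((s.sort (· ≤ ·)).reverse) generalizing k with
  | nil => simp
  | cons a l ih =>
    cases k with
    | zero => simp
    | succ k => rw [Finset.sum_range_succ']; simp [ih, add_comm]

theorem dparts_total (s : Multiset ℕ) : ∃ N, ∀ k, N ≤ k →
    ∑ i ∈ Finset.range k, dparts s i = s.sum := by
  refine ⟨Multiset.card s, fun k hk => ?_⟩
  rw [← dparts_eq, List.take_of_length_le (by simpa using hk), List.sum_reverse,
    ← Multiset.sum_coe, Multiset.sort_eq]

theorem dparts_antitone (s : Multiset ℕ) : Antitone (dparts s) := by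
  have h : ((s.sort (· ≤ ·)).reverse).Pairwise (· ≥ ·) := by
    rw [List.pairwise_reverse]
    exact s.pairwise_sort (· ≤ ·)
  refine antitone_nat_of_succ_le fun k => ?_
  unfold dparts
  by_cases hk : k + 1 < ((s.sort (· ≤ ·)).reverse).length
  · rw [List.getD_eq_getElem _ _ hk, List.getD_eq_getElem _ _ (by omega)]
    exact List.pairwise_iff_getElem.1 h k (k+1) _ _ (by omega)
  · rw [List.getD_eq_default _ _ (by omega)]; omega

/-- Generalised tabloids with an arbitrary size function. -/
def IsTab (G : Type) [CommGroup G] (n : ℕ) (s : ℕ ⊕ ℕ → ℕ)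
    (T : (Fin n → ℕ ⊕ ℕ) × (Fin n → G)) : Prop :=
  (∀ b, Nat.card {a : Fin n // T.1 a = b} = s b) ∧ (∀ a j, T.1 a = Sum.inr j → T.2 a = 1)

theorem isTabloid_iff (G : Type) [CommGroup G] (n : ℕ) (σ ρ : Multiset ℕ)
    (T : (Fin n → ℕ ⊕ ℕ) × (Fin n → G)) :
    IsTabloid G n σ ρ T ↔ IsTab G n (Sum.elim (dparts σ) (dparts ρ)) T := by
  unfold IsTabloid IsTab
  rw [Sum.forall]
  simp [and_assoc]

section action
variable {G : Type} [CommGroup G] {n : ℕ}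

instance wrFinite [Fintype G] : Finite (Wr G n) :=
  Finite.of_equiv _ (SemidirectProduct.equivProd (φ := permMulAut G n)).symm

theorem wr_mul_left (u v : Wr G n) (a : Fin n) :
    (u * v).left a = u.left a * v.left (u.right⁻¹ a) := rfl

theorem wr_mul_right (u v : Wr G n) : (u * v).right = u.right * v.right := rfl

theorem tabAct_mul (u v : Wr G n) (T : (Fin n → ℕ ⊕ ℕ) × (Fin n → G)) :
    tabAct (u * v) T = tabAct u (tabAct v T) := by
  unfold tabAct
  refine Prod.ext (funext fun a => ?_) (funext fun a => ?_)
  · simp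
  · simp only [wr_mul_right, mul_inv_rev, Equiv.Perm.mul_apply, wr_mul_left]
    cases h : T.1 (v.right⁻¹ (u.right⁻¹ a)) with
    | inl i => simp only; rw [mul_assoc, mul_comm (u.left a)]
    | inr j => rfl

theorem tabAct_one {s : ℕ ⊕ ℕ → ℕ} {T : (Fin n → ℕ ⊕ ℕ) × (Fin n → G)} (hT : IsTab G n s T) :
    tabAct 1 T = T := by
  unfold tabAct
  refine Prod.ext (funext fun a => ?_) (funext fun a => ?_)
  · simp
  · simp only [SemidirectProduct.one_right, inv_one, Equiv.Perm.one_apply,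
      SemidirectProduct.one_left, Pi.one_apply, mul_one]
    cases h : T.1 a with
    | inl i => rfl
    | inr j => exact (hT.2 a j h).symm

theorem tabAct_isTab {s : ℕ ⊕ ℕ → ℕ} {T : (Fin n → ℕ ⊕ ℕ) × (Fin n → G)} (hT : IsTab G n s T)
    (w : Wr G n) : IsTab G n s (tabAct w T) := by
  refine ⟨fun b => ?_, fun a j h => ?_⟩
  · rw [← hT.1 b]
    refine Nat.card_congr ((w.right⁻¹ : Equiv.Perm (Fin n)).subtypeEquiv fun a => ?_)
    rfl
  · unfold tabAct at h ⊢
    simp only at h ⊢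
    rw [h]

/-- The whole group is transitive on tabloids. -/
theorem exists_act {s : ℕ ⊕ ℕ → ℕ} {T U : (Fin n → ℕ ⊕ ℕ) × (Fin n → G)} (hT : IsTab G n s T)
    (hU : IsTab G n s U) : ∃ w : Wr G n, tabAct w T = U := by
  classical
  have e : ∀ b, Nonempty ({a : Fin n // T.1 a = b} ≃ {a : Fin n // U.1 a = b}) := fun b =>
    Finite.card_eq.1 ((hT.1 b).trans (hU.1 b).symm)
  replace e := fun b => (e b).some
  let E : Fin n ≃ Fin n := (Equiv.sigmaFiberEquiv T.1).symm.trans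
    ((Equiv.sigmaCongrRight e).trans (Equiv.sigmaFiberEquiv U.1))
  have hE : ∀ a, U.1 (E a) = T.1 a := fun a => ((e (T.1 a)) ⟨a, rfl⟩).2
  have hE' : ∀ a, T.1 (E⁻¹ a) = U.1 a := fun a => by
    rw [← hE]; simp
  refine ⟨⟨fun a => (T.2 (E⁻¹ a))⁻¹ * U.2 a, E⟩, ?_⟩
  unfold tabAct
  refine Prod.ext (funext fun a => ?_) (funext fun a => ?_)
  · exact hE' a
  · simp only
    cases h : T.1 (E⁻¹ a) with
    | inl i => simp
    | inr j => exact (hU.2 a j (by rw [← hE', h])).symm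

theorem act_update_iff (y : Wr G n) (I J : ℕ ⊕ ℕ) (hIJ : I ≠ J) (hs : I.isLeft = J.isLeft)
    (A A' : Fin n → ℕ ⊕ ℕ) (f f' : Fin n → G) (x : Fin n) :
    (A x = J ∧ tabAct y (A', f') = (Function.update A x I, f)) ↔
    (A' (y.right⁻¹ x) = I ∧ tabAct y (Function.update A' (y.right⁻¹ x) J, f') = (A, f)) := by
  unfold tabAct
  simp only [Prod.mk.injEq]
  have key : ∀ a, ∀ B B' : ℕ ⊕ ℕ, B.isLeft = B'.isLeft →
      (match B with
        | Sum.inl _ => f' (y.right⁻¹ a) * y.left a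
        | Sum.inr _ => 1) = 
      (match B' with
        | Sum.inl _ => f' (y.right⁻¹ a) * y.left a
        | Sum.inr _ => 1) := by
    intro a B B' h
    cases B <;> cases B' <;> simp_all
  constructor
  · rintro ⟨hx, h1, h2⟩
    have h3 : A' (y.right⁻¹ x) = I := by rw [congrFun h1 x]; simp
    have h4 : ∀ a, (Function.update A' (y.right⁻¹ x) J (y.right⁻¹ a)) = A a := by
      intro a
      by_cases ha : a = x
      · subst ha; simp [hx]
      · rw [Function.update_of_ne (by simpa using ha), congrFun h1 a, Function.update_of_ne ha]
    refine ⟨h3, funext h4, ?_⟩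
    rw [← h2]
    funext a
    refine key a _ _ ?_
    by_cases ha : a = x
    · subst ha; rw [h3]; simp [hs]
    · rw [Function.update_of_ne (by simpa using ha)]
  · rintro ⟨h3, h1, h2⟩
    have hx : A x = J := by rw [← congrFun h1 x]; simp
    refine ⟨hx, ?_, ?_⟩
    · funext a
      by_cases ha : a = x
      · subst ha; rw [h3]; simp
      · rw [Function.update_of_ne ha, ← congrFun h1 a, Function.update_of_ne (by simpa using ha)]
    · rw [← h2]
      funext a
      refine key a _ _ ?_
      by_cases ha : a = x
      · subst ha; rw [h3]; simp [hs]
      · rw [Function.update_of_ne (by simpa using ha)]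

open Classical in
theorem card_update (A : Fin n → ℕ ⊕ ℕ) (x : Fin n) (I b : ℕ ⊕ ℕ) (hAI : A x ≠ I) :
    Nat.card {a // Function.update A x I a = b} + (if b = A x then 1 else 0) =
    Nat.card {a // A a = b} + (if b = I then 1 else 0) := by
  have h1 : ∀ B : Fin n → ℕ ⊕ ℕ, Nat.card {a // B a = b} = (if B x = b then 1 else 0) +
      ∑ a ∈ Finset.univ.erase x, if B a = b then 1 else 0 := by
    intro B
    rw [Finset.add_sum_erase _ (fun a => if B a = b then 1 else 0) (Finset.mem_univ x),
      Nat.card_eq_fintype_card, Fintype.card_subtype, Finset.card_filter]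
  rw [h1, h1]
  have h2 : ∑ a ∈ Finset.univ.erase x, (if Function.update A x I a = b then 1 else 0) =
      ∑ a ∈ Finset.univ.erase x, if A a = b then 1 else 0 :=
    Finset.sum_congr rfl fun a ha => by rw [Function.update_of_ne (Finset.ne_of_mem_erase ha)]
  rw [h2, Function.update_self]
  simp only [eq_comm (a := b)]
  omega

theorem isTab_update_iff (s : ℕ ⊕ ℕ → ℕ) (I J : ℕ ⊕ ℕ) (hIJ : I ≠ J) (hs : I.isLeft = J.isLeft)
    (hJ : 1 ≤ s J) (A : Fin n → ℕ ⊕ ℕ) (f : Fin n → G) (x : Fin n) (hx : A x = J) :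
    IsTab G n (Function.update (Function.update s I (s I + 1)) J (s J - 1))
      (Function.update A x I, f) ↔ IsTab G n s (A, f) := by
  classical
  unfold IsTab
  refine and_congr (forall_congr' fun b => ?_) (forall_congr' fun a => ?_)
  · have h := card_update A x I b (by rw [hx]; exact hIJ.symm)
    simp only
    rw [hx] at h
    by_cases h1 : b = J
    · subst h1
      rw [if_pos rfl, if_neg hIJ.symm] at h
      rw [Function.update_self]; omega
    · by_cases h2 : b = I
      · subst h2
        rw [if_neg h1, if_pos rfl] at h
        rw [Function.update_of_ne h1, Function.update_self]; omega
      · rw [if_neg h1, if_neg h2] at h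
        rw [Function.update_of_ne h1, Function.update_of_ne h2]; omega
  · simp only
    by_cases ha : a = x
    · subst ha
      rw [Function.update_self, hx]
      cases I <;> cases J <;> simp_all
    · rw [Function.update_of_ne ha]

theorem natCard_eq_sum [Fintype (Wr G n)] (p : Wr G n → Prop) [DecidablePred p] :
    Nat.card {y // p y} = ∑ y, if p y then 1 else 0 := by
  rw [Nat.card_eq_fintype_card, Fintype.card_subtype, Finset.card_filter]

/-- The elementary step: moving a box upwards preserves transitivity. -/
theorem trans_step [Fintype G] (Y : Set (Wr G n)) (s : ℕ ⊕ ℕ → ℕ) (I J : ℕ ⊕ ℕ) (hIJ : I ≠ J)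
    (hs : I.isLeft = J.isLeft) (hJ : 1 ≤ s J) (hJI : s J ≤ s I)
    (hY : IsTransitiveOn tabAct {T | IsTab G n s T} Y) :
    IsTransitiveOn tabAct
      {T | IsTab G n (Function.update (Function.update s I (s I + 1)) J (s J - 1)) T} Y := by
  classical
  haveI : Fintype (Wr G n) := Fintype.ofFinite _
  obtain ⟨c, hc, hY⟩ := hY
  set s' := Function.update (Function.update s I (s I + 1)) J (s J - 1) with hs'
  have hs'I : s' I = s I + 1 := by simp [s', hIJ]
  have hs'J : s' J = s J - 1 := by simp [s']
  let N : ((Fin n → ℕ ⊕ ℕ) × (Fin n → G)) → ((Fin n → ℕ ⊕ ℕ) × (Fin n → G)) → ℕ :=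
    fun a b => Nat.card {y : Wr G n // y ∈ Y ∧ tabAct y a = b}
  have hcount : ∀ A' f' A f, IsTab G n s' (A', f') → IsTab G n s (A, f) →
      ∑ x, (if A x = J then N (A', f') (Function.update A x I, f) else 0) = c * (s I + 1) := by
    intro A' f' A f hA' hA
    have e1 : ∑ x, (if A x = J then N (A', f') (Function.update A x I, f) else 0) =
        ∑ y : Wr G n, ∑ x, if y ∈ Y ∧ (A x = J ∧ tabAct y (A', f') = (Function.update A x I, f))
          then 1 else 0 := by
      rw [Finset.sum_comm]
      refine Finset.sum_congr rfl fun x _ => ?_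
      by_cases hx : A x = J
      · simp only [hx, if_true, true_and, N]
        rw [natCard_eq_sum]
      · simp [hx]
    have e2 : ∑ z, (if A' z = I then N (Function.update A' z J, f') (A, f) else 0) =
        ∑ y : Wr G n, ∑ z, if y ∈ Y ∧ (A' z = I ∧ tabAct y (Function.update A' z J, f') = (A, f))
          then 1 else 0 := by
      rw [Finset.sum_comm]
      refine Finset.sum_congr rfl fun x _ => ?_
      by_cases hx : A' x = I
      · simp only [hx, if_true, true_and, N]
        rw [natCard_eq_sum]
      · simp [hx]
    have e3 : ∑ z, (if A' z = I then N (Function.update A' z J, f') (A, f) else 0) =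
        ∑ z, (if A' z = I then c else 0) := by
      refine Finset.sum_congr rfl fun z _ => ?_
      by_cases hz : A' z = I
      · rw [if_pos hz, if_pos hz]
        refine hY _ ?_ _ hA
        change IsTab G n s _
        rw [← isTab_update_iff s I J hIJ hs hJ (Function.update A' z J) f' z (by simp)]
        have hzz : Function.update (Function.update A' z J) z I = A' := by simp [← hz]
        rw [hzz]; exact hA'
      · rw [if_neg hz, if_neg hz]
    rw [e1]
    have e4 : ∀ y : Wr G n, (∑ x, if y ∈ Y ∧ (A x = J ∧
          tabAct y (A', f') = (Function.update A x I, f)) then 1 else 0) =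
        ∑ z, if y ∈ Y ∧ (A' z = I ∧ tabAct y (Function.update A' z J, f') = (A, f))
          then 1 else 0 := by
      intro y
      simp only [act_update_iff y I J hIJ hs A A' f f']
      exact Equiv.sum_comp (y.right⁻¹) (fun z => if y ∈ Y ∧ (A' z = I ∧
        tabAct y (Function.update A' z J, f') = (A, f)) then 1 else 0)
    simp only [e4]
    rw [← e2, e3, ← Finset.sum_filter, Finset.sum_const, smul_eq_mul, mul_comm,
      ← Fintype.card_subtype, ← Nat.card_eq_fintype_card, ← hs'I]
    congr 1
    exact hA'.1 I
  have hmain : ∀ A' f' B f, IsTab G n s' (A', f') → IsTab G n s' (B, f) →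
      s J * N (A', f') (B, f) = c * (s I + 1) := by
    intro A' f' B f hA' hB
    let S : Finset (ℕ ⊕ ℕ) := insert I (insert J (Finset.univ.image B))
    let L := {b // b ∈ S}
    let I' : L := ⟨I, by simp [S]⟩
    let J' : L := ⟨J, by simp [S]⟩
    let v : (Fin n → L) → ℤ := fun A =>
      if IsTab G n s' (fun a => (A a).1, f) then
        (s J : ℤ) * N (A', f') (fun a => (A a).1, f) - c * (s I + 1) else 0
    have hupd : ∀ (A : Fin n → L) x, (fun a => (Function.update A x I' a).1) =
        Function.update (fun a => (A a).1) x I := by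
      intro A x
      funext a
      by_cases ha : a = x
      · subst ha; simp [I']
      · simp [ha]
    have hv := mvOp_inj I' J' (fun h => hIJ (congrArg Subtype.val h)) v ?_ ?_
    · have := hv (fun a => ⟨B a, by simp [S]⟩)
      simp only [v] at this
      rw [if_pos hB] at this
      have h2 : (s J : ℤ) * N (A', f') (B, f) = c * (s I + 1) := by linarith
      exact_mod_cast h2
    · intro A hA
      have hT : IsTab G n s' (fun a => (A a).1, f) := by
        by_contra h; exact hA (if_neg h)
      have h1 := hT.1 I
      have h2 := hT.1 J
      rw [Nat.card_eq_fintype_card, Fintype.card_subtype] at h1 h2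
      have h3 : (Finset.univ.filter fun x => A x = I') =
        Finset.univ.filter fun x => (A x).1 = I := by
        ext x
        simp only [Finset.mem_filter, Finset.mem_univ, true_and]
        exact ⟨fun h => congrArg Subtype.val h, fun h => Subtype.ext h⟩
      have h4 : (Finset.univ.filter fun x => A x = J') =
        Finset.univ.filter fun x => (A x).1 = J := by
        ext x
        simp only [Finset.mem_filter, Finset.mem_univ, true_and]
        exact ⟨fun h => congrArg Subtype.val h, fun h => Subtype.ext h⟩
      rw [h3, h4]
      simp only at h1 h2
      rw [h1, h2, hs'I, hs'J]
      omega
    · intro A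
      unfold mvOp
      have hJJ : ∀ x, A x = J' ↔ (A x).1 = J := fun x =>
        ⟨fun h => congrArg Subtype.val h, fun h => Subtype.ext h⟩
      by_cases hA : IsTab G n s (fun a => (A a).1, f)
      · have h1 := hcount A' f' _ _ hA' hA
        have h2 : ∀ x, (if A x = J' then v (Function.update A x I') else 0) =
            (s J : ℤ) * (if (A x).1 = J then
              (N (A', f') (Function.update (fun a => (A a).1) x I, f) : ℤ) else 0) -
            (if (A x).1 = J then ((c : ℤ) * (s I + 1)) else 0) := by
          intro x
          by_cases hx : (A x).1 = J
          · rw [if_pos ((hJJ x).2 hx), if_pos hx, if_pos hx]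
            simp only [v]
            rw [hupd, if_pos]
            exact (isTab_update_iff s I J hIJ hs hJ _ f x hx).2 hA
          · rw [if_neg fun h => hx ((hJJ x).1 h), if_neg hx, if_neg hx]; simp
        simp only [h2]
        rw [Finset.sum_sub_distrib, ← Finset.mul_sum]
        have h3 : ∑ x, (if (A x).1 = J then
              (N (A', f') (Function.update (fun a => (A a).1) x I, f) : ℤ) else 0) =
            c * (s I + 1) := by
          exact_mod_cast h1
        have h4 := hA.1 J
        rw [Nat.card_eq_fintype_card, Fintype.card_subtype] at h4
        simp only at h4
        rw [h3, ← Finset.sum_filter, Finset.sum_const, h4]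
        simp
      · refine Finset.sum_eq_zero fun x _ => ?_
        by_cases hx : (A x).1 = J
        · rw [if_pos ((hJJ x).2 hx)]
          simp only [v]
          rw [hupd, if_neg]
          rw [isTab_update_iff s I J hIJ hs hJ _ f x hx]
          exact hA
        · rw [if_neg fun h => hx ((hJJ x).1 h)]
  by_cases hne : ∃ T, IsTab G n s' T
  · obtain ⟨T, hT⟩ := hne
    have h0 := hmain T.1 T.2 T.1 T.2 hT hT
    refine ⟨N T T, ?_, fun a ha b hb => ?_⟩
    · by_contra h
      have : N T T = 0 := by omega
      rw [show (T.1, T.2) = T from rfl, this] at h0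
      have : 0 < c * (s I + 1) := by positivity
      omega
    · have h1 := hmain a.1 a.2 b.1 b.2 ha hb
      exact Nat.eq_of_mul_eq_mul_left (by omega) (h1.trans h0.symm)
  · exact ⟨1, one_pos, fun a ha => (hne ⟨a, ha⟩).elim⟩

end action

theorem dom_forward (G : Type) [CommGroup G] [Fintype G] (n : ℕ) (σ ρ τ π : Multiset ℕ)
    (h1 : σ.sum = τ.sum) (h2 : ρ.sum = π.sum) (hd1 : msDom σ τ) (hd2 : msDom ρ π) :
    DPDom G n σ ρ τ π := by
  intro Y hY
  have hconv : ∀ α β : Multiset ℕ, {T | IsTabloid G n α β T} =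
      {T | IsTab G n (Sum.elim (dparts α) (dparts β)) T} := fun α β =>
    Set.ext fun T => isTabloid_iff G n α β T
  unfold DPTransitive at hY ⊢
  rw [hconv] at hY ⊢
  have key : ∀ (P : (ℕ → ℕ) → Prop) (_ : ∀ s i j, i < j → 1 ≤ s j → s j ≤ s i → P s →
      P (Function.update (Function.update s i (s i + 1)) j (s j - 1))) (α β : Multiset ℕ),
      α.sum = β.sum → msDom α β → P (dparts α) → P (dparts β) := by
    intro P hP α β hs hd
    obtain ⟨N1, hN1⟩ := dparts_total α
    obtain ⟨N2, hN2⟩ := dparts_total β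
    refine dom_chain P hP (dparts β) (dparts_antitone β) (max N1 N2) _ (dparts α)
      (dparts_antitone α) ?_ ?_ (Nat.le_add_right _ _)
    · intro k
      rw [← dparts_eq, ← dparts_eq]; exact hd k
    · intro k hk
      rw [hN1 k (le_trans (le_max_left _ _) hk), hN2 k (le_trans (le_max_right _ _) hk), hs]
  have hm : IsTransitiveOn tabAct {T | IsTab G n (Sum.elim (dparts τ) (dparts ρ)) T} Y := by
    refine key (fun s => IsTransitiveOn tabAct {T | IsTab G n (Sum.elim s (dparts ρ)) T} Y)
      ?_ σ τ h1 hd1 hY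
    intro s i j hij hj hji hP
    have := trans_step Y (Sum.elim s (dparts ρ)) (Sum.inl i) (Sum.inl j)
      (by simpa using hij.ne) rfl hj hji hP
    simpa [← Sum.elim_update_left] using this
  refine key (fun s => IsTransitiveOn tabAct {T | IsTab G n (Sum.elim (dparts τ) s) T} Y)
      ?_ ρ π h2 hd2 hm
  intro s i j hij hj hji hP
  have := trans_step Y (Sum.elim (dparts τ) s) (Sum.inr i) (Sum.inr j)
      (by simpa using hij.ne) rfl hj hji hP
  simpa [← Sum.elim_update_right] using this

section counting

theorem cnt_split {W : Type} [Finite W] (p q : W → Prop) :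
    Nat.card {w // p w} = Nat.card {w // p w ∧ q w} + Nat.card {w // p w ∧ ¬ q w} := by
  classical
  haveI := Fintype.ofFinite W
  simp only [Nat.card_eq_fintype_card, Fintype.card_subtype]
  rw [← Finset.filter_filter, ← Finset.filter_filter, Finset.card_filter_add_card_filter_not]

theorem cnt_congr {W : Type} {p q : W → Prop} (h : ∀ w, p w ↔ q w) :
    Nat.card {w // p w} = Nat.card {w // q w} := by
  have : p = q := funext fun w => propext (h w)
  rw [this]

theorem cnt_swap {W : Type} [Finite W] {p q : W → Prop} (Φ : W → W) (hΦ : Function.Injective Φ)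
    (h1 : ∀ w, p w → q (Φ w)) (h2 : ∀ w, q w → p (Φ w)) :
    Nat.card {w // p w} = Nat.card {w // q w} := by
  refine le_antisymm ?_ ?_
  · exact Nat.card_le_card_of_injective (fun w : {w // p w} => (⟨Φ w.1, h1 _ w.2⟩ : {w // q w}))
      fun a b h => Subtype.ext (hΦ (congrArg Subtype.val h))
  · exact Nat.card_le_card_of_injective (fun w : {w // q w} => (⟨Φ w.1, h2 _ w.2⟩ : {w // p w}))
      fun a b h => Subtype.ext (hΦ (congrArg Subtype.val h))

theorem cnt_single {W : Type} {p : W → Prop} (k : W) (h : ∀ w, p w ↔ w = k) :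
    Nat.card {w // p w} = 1 := by
  rw [cnt_congr h]; simp

end counting

section converse
variable {G : Type} [CommGroup G] {n : ℕ}

/-- Product of all colours. -/
def colProd (w : Wr G n) : G := ∏ x, w.left x

theorem colProd_mul (u v : Wr G n) : colProd (u * v) = colProd u * colProd v := by
  unfold colProd
  simp only [wr_mul_left]
  rw [Finset.prod_mul_distrib]
  congr 1
  exact Equiv.prod_comp (u.right⁻¹) v.left

/-- Twisted transposition. -/
theorem tw_exists {s : ℕ ⊕ ℕ → ℕ} {A : Fin n → ℕ ⊕ ℕ} {f : Fin n → G} (h : IsTab G n s (A, f))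
    (x y : Fin n) (hA : A x = A y) :
    ∃ t : Wr G n, t.right = Equiv.swap x y ∧ colProd t = 1 ∧ tabAct t (A, f) = (A, f) ∧
      ∀ z j, A z = Sum.inr j → t.left z = 1 := by
  have hsw : ∀ z, A (Equiv.swap x y z) = A z := by
    intro z
    by_cases h1 : z = x
    · subst h1; simp [hA]
    by_cases h2 : z = y
    · subst h2; simp [hA]
    rw [Equiv.swap_apply_of_ne_of_ne h1 h2]
  refine ⟨⟨fun z => f z * (f (Equiv.swap x y z))⁻¹, Equiv.swap x y⟩, rfl, ?_, ?_, ?_⟩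
  · unfold colProd
    simp only
    rw [Finset.prod_mul_distrib, Finset.prod_inv_distrib, Equiv.prod_comp (Equiv.swap x y) f,
      mul_inv_cancel]
  · unfold tabAct
    refine Prod.ext (funext fun a => ?_) (funext fun a => ?_)
    · simp [hsw]
    · simp only [Equiv.swap_inv, hsw]
      cases hz : A a with
      | inl i => simp only; rw [mul_comm (f a), mul_inv_cancel_left]
      | inr j => exact (h.2 a j hz).symm
  · intro z j hz
    simp only
    have h1 : f z = 1 := h.2 z j hz
    have h2 : f (Equiv.swap x y z) = 1 := h.2 (Equiv.swap x y z) j (by simpa [hsw] using hz)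
    rw [h1, h2]
    simp

/-- Colour change at a single point. -/
def single (x : Fin n) (g : G) : Wr G n := ⟨Pi.mulSingle x g, 1⟩

theorem colProd_single (x : Fin n) (g : G) : colProd (single x g) = g := by
  unfold colProd single
  simp

theorem single_mul_single (x : Fin n) (g h : G) :
    single x g * single x h = single x (g * h) := by
  unfold single
  refine SemidirectProduct.ext ?_ ?_
  · funext a
    rw [wr_mul_left]
    simp [Pi.mulSingle_mul]
    rfl
  · simp

theorem single_one (x : Fin n) : single x (1 : G) = 1 := by
  unfold single
  refine SemidirectProduct.ext ?_ ?_ <;> simp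

theorem single_act {s : ℕ ⊕ ℕ → ℕ} {A : Fin n → ℕ ⊕ ℕ} {f : Fin n → G} (h : IsTab G n s (A, f))
    (x : Fin n) (hx : (A x).isLeft = false) (g : G) : tabAct (single x g) (A, f) = (A, f) := by
  unfold tabAct single
  refine Prod.ext (funext fun a => ?_) (funext fun a => ?_)
  · simp
  · simp only [inv_one, Equiv.Perm.one_apply]
    cases hz : A a with
    | inl i =>
      have : a ≠ x := by rintro rfl; simp [hz] at hx
      simp [this]
    | inr j => exact (h.2 a j hz).symm

/-- The analogue of the column group. -/
def KK (T : Fin n → ℕ ⊕ ℕ) (col : Fin n → ℕ) (w : Wr G n) : Prop :=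
  (∀ x, col (w.right x) = col x ∧ (T (w.right x)).isLeft = (T x).isLeft) ∧
  (∀ x, (T x).isLeft = false → w.left x = 1)

theorem KK.mul {T : Fin n → ℕ ⊕ ℕ} {col : Fin n → ℕ} {u v : Wr G n} (hu : KK T col u)
    (hv : KK T col v) : KK T col (u * v) := by
  refine ⟨fun x => ?_, fun x hx => ?_⟩
  · rw [wr_mul_right]
    simp only [Equiv.Perm.mul_apply]
    exact ⟨(hu.1 _).1.trans (hv.1 x).1, (hu.1 _).2.trans (hv.1 x).2⟩
  · rw [wr_mul_left, hu.2 x hx, hv.2, mul_one]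
    have := (hu.1 (u.right⁻¹ x)).2
    rw [← this]; simpa using hx

theorem KK.inv_apply {T : Fin n → ℕ ⊕ ℕ} {col : Fin n → ℕ} {u : Wr G n} (hu : KK T col u)
    (x : Fin n) : col (u.right⁻¹ x) = col x ∧ (T (u.right⁻¹ x)).isLeft = (T x).isLeft := by
  have := hu.1 (u.right⁻¹ x)
  rw [show u.right (u.right⁻¹ x) = x from Equiv.apply_symm_apply _ _] at this
  exact ⟨this.1.symm, this.2.symm⟩

theorem KK.single {T : Fin n → ℕ ⊕ ℕ} {col : Fin n → ℕ} (x : Fin n) (hx : (T x).isLeft = true)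
    (g : G) : KK T col (single x g) := by
  refine ⟨fun z => by simp [_root_.single], fun z hz => ?_⟩
  have : z ≠ x := by rintro rfl; simp [hz] at hx
  simp [_root_.single, this]

theorem KK.act_inj {T : Fin n → ℕ ⊕ ℕ} {col : Fin n → ℕ}
    (hinj : ∀ x y, T x = T y → col x = col y → x = y) {u v : Wr G n} (hu : KK T col u)
    (hv : KK T col v) (h : tabAct u (T, 1) = tabAct v (T, 1)) : u = v := by
  have hr : ∀ a, u.right⁻¹ a = v.right⁻¹ a := by
    intro a
    refine hinj _ _ (congrFun (congrArg Prod.fst h) a) ?_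
    rw [(hu.inv_apply a).1, (hv.inv_apply a).1]
  have hr' : u.right = v.right := inv_injective (Equiv.ext hr)
  refine SemidirectProduct.ext (funext fun a => ?_) hr'
  cases hs : (T a).isLeft with
  | false => rw [hu.2 a hs, hv.2 a hs]
  | true =>
    have h2 := congrFun (congrArg Prod.snd h) a
    unfold tabAct at h2
    simp only [← hr'] at h2
    have h3 := (hu.inv_apply a).2
    rw [hs] at h3
    cases h4 : T (u.right⁻¹ a) with
    | inl i => rw [h4] at h2; simpa using h2
    | inr j => rw [h4] at h3; simp at h3

theorem exists_pair {s : ℕ ⊕ ℕ → ℕ} {A : Fin n → ℕ ⊕ ℕ} {f : Fin n → G} (h : IsTab G n s (A, f))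
    (b : ℕ ⊕ ℕ) (hb : 2 ≤ s b) : ∃ x y, x ≠ y ∧ A x = A y := by
  rw [← h.1 b] at hb
  obtain ⟨x, y, hxy⟩ := (Finite.one_lt_card_iff_nontrivial.1 hb).exists_pair_ne
  exact ⟨x.1, y.1, fun h => hxy (Subtype.ext h), x.2.trans y.2.symm⟩

theorem card_F {s : ℕ ⊕ ℕ → ℕ} [Fintype G] {a b a' b' : (Fin n → ℕ ⊕ ℕ) × (Fin n → G)}
    (ha : IsTab G n s a) (hb : IsTab G n s b) (ha' : IsTab G n s a') (hb' : IsTab G n s b') :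
    Nat.card {w : Wr G n // tabAct w a = b} ≤ Nat.card {w : Wr G n // tabAct w a' = b'} := by
  obtain ⟨u, hu⟩ := exists_act ha' ha
  obtain ⟨v, hv⟩ := exists_act hb hb'
  refine Nat.card_le_card_of_injective
    (fun w : {w : Wr G n // tabAct w a = b} =>
      (⟨v * (w.1 * u), by rw [tabAct_mul, tabAct_mul, hu, w.2, hv]⟩ :
        {w : Wr G n // tabAct w a' = b'})) fun w w' h => ?_
  have := congrArg Subtype.val h
  exact Subtype.ext (mul_right_cancel (mul_left_cancel this))

theorem not_dom [Fintype G] [Nontrivial G] (s s' : ℕ ⊕ ℕ → ℕ) (T : Fin n → ℕ ⊕ ℕ)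
    (col : Fin n → ℕ) (hT : IsTab G n s' (T, 1))
    (hinj : ∀ x y, T x = T y → col x = col y → x = y)
    (hA : ∀ A f, IsTab G n s (A, f) →
      (∃ x, (T x).isLeft = true ∧ (A x).isLeft = false) ∨
      (∃ x y, x ≠ y ∧ A x = A y ∧ col x = col y ∧ ∀ z, (A z).isLeft = (T z).isLeft))
    (hblk : ∃ b, 2 ≤ s b)
    (hxy : ∃ x y, x ≠ y ∧ col x = col y ∧ (T x).isLeft = (T y).isLeft)
    (hne : ∃ a, IsTab G n s a)
    (hall : ∀ Y : Set (Wr G n), IsTransitiveOn tabAct {T | IsTab G n s T} Y →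
      IsTransitiveOn tabAct {T | IsTab G n s' T} Y) : False := by
  classical
  obtain ⟨g0, hg0⟩ := exists_ne (1 : G)
  obtain ⟨b0, hb0⟩ := hblk
  obtain ⟨a0, ha0⟩ := hne
  let sg : Wr G n → ℤˣ := fun w => Equiv.Perm.sign w.right
  have hsg_mul : ∀ u v, sg (u * v) = sg u * sg v := fun u v => by
    simp only [sg, wr_mul_right, map_mul]
  have hsg_sw : ∀ (t : Wr G n) x y, x ≠ y → t.right = Equiv.swap x y → sg t = -1 := by
    intro t x y h1 h2
    simp only [sg, h2, Equiv.Perm.sign_swap h1]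
  have hpm : ∀ w, sg w = 1 ∨ sg w = -1 := fun w => Int.units_eq_one_or _
  have hneg : (-1 : ℤˣ) ≠ 1 := by decide
  let D : Wr G n → Prop := fun w => KK T col w ∧ (colProd w = 1 ∨ colProd w = g0)
  let Y : Wr G n → Prop := fun w => (sg w = 1 ↔ colProd w ≠ 1)
  let Y' : Wr G n → Prop := fun w => ¬ (Y w ↔ D w)
  have hflip : ∀ w t, sg t = -1 → colProd t = 1 → (Y (w * t) ↔ ¬ Y w) := by
    intro w t h1 h2
    simp only [Y, hsg_mul, colProd_mul, h1, h2, mul_one]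
    rcases hpm w with h | h <;> simp [h, hneg]
  have hbase : ∀ a b, IsTab G n s a → IsTab G n s b →
      Nat.card {w : Wr G n // tabAct w a = b} =
        2 * Nat.card {w : Wr G n // Y w ∧ tabAct w a = b} := by
    intro a b ha hb
    obtain ⟨x, y, hne, hxy⟩ := exists_pair (A := a.1) (f := a.2) ha b0 hb0
    obtain ⟨t, ht1, ht2, ht3, -⟩ := tw_exists (A := a.1) (f := a.2) ha x y hxy
    have ht := hsg_sw t x y hne ht1
    rw [cnt_split _ Y, two_mul]
    congr 1
    · exact cnt_congr fun w => and_comm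
    · refine cnt_swap (fun w => w * t) (mul_left_injective t) ?_ ?_
      · rintro w ⟨h1, h2⟩
        exact ⟨(hflip w t ht ht2).2 h2, by rw [tabAct_mul, ht3]; exact h1⟩
      · rintro w ⟨h1, h2⟩
        exact ⟨by rw [tabAct_mul, ht3]; exact h2, fun h => (hflip w t ht ht2).1 h h1⟩
  have hYtrans : ∀ Z : Wr G n → Prop, (∀ a b, IsTab G n s a → IsTab G n s b →
      Nat.card {w : Wr G n // Z w ∧ tabAct w a = b} =
        Nat.card {w : Wr G n // Y w ∧ tabAct w a = b}) →
      IsTransitiveOn tabAct {T | IsTab G n s T} {w | Z w} := by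
    intro Z hZ
    refine ⟨Nat.card {w : Wr G n // Y w ∧ tabAct w a0 = a0}, ?_, fun a ha b hb => ?_⟩
    · have h1 := hbase a0 a0 ha0 ha0
      have h2 : 0 < Nat.card {w : Wr G n // tabAct w a0 = a0} := by
        haveI : Nonempty {w : Wr G n // tabAct w a0 = a0} := ⟨⟨1, tabAct_one ha0⟩⟩
        exact Nat.card_pos
      omega
    · have h1 := hbase a0 a0 ha0 ha0
      have h2 := hbase a b ha hb
      have h3 := le_antisymm (card_F ha0 ha0 ha hb) (card_F ha hb ha0 ha0)
      have h4 := hZ a b ha hb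
      change Nat.card {w : Wr G n // Z w ∧ tabAct w a = b} = _
      omega
  have hDY : ∀ a b, IsTab G n s a → IsTab G n s b →
      Nat.card {w : Wr G n // (Y w ∧ tabAct w a = b) ∧ D w} =
      Nat.card {w : Wr G n // (¬ Y w ∧ tabAct w a = b) ∧ D w} := by
    intro a b ha hb
    rcases hA a.1 a.2 ha with ⟨x, hx1, hx2⟩ | ⟨x, y, hne, hxy, hcol, hside⟩
    · let q : G → G := fun p => p⁻¹ * Equiv.swap 1 g0 p
      let Φ : Wr G n → Wr G n := fun w => w * single x (q (colProd w))
      have hprod : ∀ w, colProd (Φ w) = Equiv.swap 1 g0 (colProd w) := by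
        intro w
        simp only [Φ, colProd_mul, colProd_single, q, mul_inv_cancel_left]
      have hinv : Function.Involutive Φ := by
        intro w
        change Φ w * single x (q (colProd (Φ w))) = w
        rw [hprod]
        simp only [Φ, mul_assoc, single_mul_single, q, Equiv.swap_apply_self]
        rw [mul_inv_cancel_left, inv_mul_cancel, single_one, mul_one]
      have hsgΦ : ∀ w, sg (Φ w) = sg w := by
        intro w
        simp only [Φ, hsg_mul]
        simp [sg, single]
      have hact : ∀ w, tabAct (Φ w) a = tabAct w a := by
        intro w
        simp only [Φ, tabAct_mul]
        rw [single_act (A := a.1) (f := a.2) ha x hx2]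
      have hD : ∀ w, D w → D (Φ w) := by
        rintro w ⟨h1, h2⟩
        refine ⟨h1.mul (KK.single x hx1 _), ?_⟩
        rw [hprod]
        rcases h2 with h2 | h2 <;> simp [h2]
      have hYΦ : ∀ w, D w → (Y (Φ w) ↔ ¬ Y w) := by
        rintro w ⟨-, h2⟩
        simp only [Y, hsgΦ, hprod]
        rcases h2 with h2 | h2 <;> simp [h2, hg0]
      refine cnt_swap Φ hinv.injective ?_ ?_
      · rintro w ⟨⟨h1, h2⟩, h3⟩
        exact ⟨⟨fun h => (hYΦ w h3).1 h h1, by rw [hact, h2]⟩, hD w h3⟩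
      · rintro w ⟨⟨h1, h2⟩, h3⟩
        exact ⟨⟨(hYΦ w h3).2 h1, by rw [hact, h2]⟩, hD w h3⟩
    · obtain ⟨t, ht1, ht2, ht3, ht4⟩ := tw_exists (A := a.1) (f := a.2) ha x y hxy
      have ht := hsg_sw t x y hne ht1
      have hKt : KK T col t := by
        refine ⟨fun z => ?_, fun z hz => ?_⟩
        · rw [ht1]
          have hTxy : (T x).isLeft = (T y).isLeft := by rw [← hside, ← hside, hxy]
          by_cases h1 : z = x
          · subst h1; simp [hcol, hTxy]
          by_cases h2 : z = y
          · subst h2; simp [hcol, hTxy]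
          rw [Equiv.swap_apply_of_ne_of_ne h1 h2]; simp
        · rw [← hside] at hz
          cases h : a.1 z with
          | inl i => rw [h] at hz; simp at hz
          | inr j => exact ht4 z j h
      have hD : ∀ w, D w → D (w * t) := by
        rintro w ⟨h1, h2⟩
        refine ⟨h1.mul hKt, ?_⟩
        rw [colProd_mul, ht2, mul_one]; exact h2
      refine cnt_swap (fun w => w * t) (mul_left_injective t) ?_ ?_
      · rintro w ⟨⟨h1, h2⟩, h3⟩
        exact ⟨⟨fun h => (hflip w t ht ht2).1 h h1, by rw [tabAct_mul, ht3]; exact h2⟩, hD w h3⟩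
      · rintro w ⟨⟨h1, h2⟩, h3⟩
        exact ⟨⟨(hflip w t ht ht2).2 h1, by rw [tabAct_mul, ht3]; exact h2⟩, hD w h3⟩
  have hsplitY : ∀ a b, Nat.card {w : Wr G n // Y w ∧ tabAct w a = b} =
      Nat.card {w : Wr G n // (Y w ∧ tabAct w a = b) ∧ D w} +
      Nat.card {w : Wr G n // (Y w ∧ tabAct w a = b) ∧ ¬ D w} := fun a b => cnt_split _ _
  have hsplitY' : ∀ a b, Nat.card {w : Wr G n // Y' w ∧ tabAct w a = b} =
      Nat.card {w : Wr G n // (¬ Y w ∧ tabAct w a = b) ∧ D w} +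
      Nat.card {w : Wr G n // (Y w ∧ tabAct w a = b) ∧ ¬ D w} := by
    intro a b
    rw [cnt_split _ D]
    congr 1
    · exact cnt_congr fun w => by simp only [Y']; tauto
    · exact cnt_congr fun w => by simp only [Y']; tauto
  obtain ⟨c, hc, hcY⟩ := hall {w | Y w} (hYtrans Y fun a b _ _ => rfl)
  obtain ⟨c', hc', hcY'⟩ := hall {w | Y' w} (hYtrans Y' fun a b ha hb => by
    rw [hsplitY, hsplitY', hDY a b ha hb])
  have hTT : ∀ k : Wr G n, IsTab G n s' (tabAct k (T, 1)) := fun k => tabAct_isTab hT k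
  have hDk : ∀ k w, D k → (tabAct w (T, 1) = tabAct k (T, 1) ∧ D w ↔ w = k) := by
    intro k w hk
    constructor
    · rintro ⟨h1, h2⟩
      exact KK.act_inj hinj h2.1 hk.1 h1
    · rintro rfl; exact ⟨rfl, hk⟩
  have hplus : ∀ k, D k → ¬ Y k → c' = c + 1 := by
    intro k hk hYk
    have h1 : Nat.card {w : Wr G n // Y w ∧ _} = c := hcY _ hT _ (hTT k)
    have h2 : Nat.card {w : Wr G n // Y' w ∧ _} = c' := hcY' _ hT _ (hTT k)
    rw [hsplitY] at h1
    rw [hsplitY'] at h2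
    rw [cnt_single k fun w => by
      rw [and_assoc, hDk k w hk]
      exact ⟨fun h => h.2, fun h => ⟨h ▸ hYk, h⟩⟩] at h2
    have h3 : Nat.card {w : Wr G n // (Y w ∧ tabAct w (T, 1) = tabAct k (T, 1)) ∧ D w} = 0 := by
      rw [cnt_congr (q := fun _ => False) fun w => by
        rw [and_assoc, hDk k w hk, iff_false]
        rintro ⟨h, rfl⟩; exact hYk h]
      simp
    omega
  have hminus : ∀ k, D k → Y k → c = c' + 1 := by
    intro k hk hYk
    have h1 : Nat.card {w : Wr G n // Y w ∧ _} = c := hcY _ hT _ (hTT k)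
    have h2 : Nat.card {w : Wr G n // Y' w ∧ _} = c' := hcY' _ hT _ (hTT k)
    rw [hsplitY] at h1
    rw [hsplitY'] at h2
    rw [cnt_single k fun w => by
      rw [and_assoc, hDk k w hk]
      exact ⟨fun h => h.2, fun h => ⟨h ▸ hYk, h⟩⟩] at h1
    have h3 : Nat.card {w : Wr G n // (¬ Y w ∧ tabAct w (T, 1) = tabAct k (T, 1)) ∧ D w} = 0 := by
      rw [cnt_congr (q := fun _ => False) fun w => by
        rw [and_assoc, hDk k w hk, iff_false]
        rintro ⟨h, rfl⟩; exact h hYk]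
      simp
    omega
  have hp1 : colProd (1 : Wr G n) = 1 := by simp [colProd]
  have e1 := hplus 1 ⟨⟨fun x => by simp, fun x _ => by simp⟩, Or.inl hp1⟩
    (by simp [Y, hp1, sg])
  obtain ⟨x, y, hne, hcol, hside⟩ := hxy
  have e2 := hminus ⟨1, Equiv.swap x y⟩ ⟨⟨fun z => ?_, fun x _ => by simp⟩,
    Or.inl (by simp [colProd])⟩ ?_
  · omega
  · simp only
    by_cases h1 : z = x
    · subst h1; simp [hcol, hside]
    by_cases h2 : z = y
    · subst h2; simp [hcol, hside]
    rw [Equiv.swap_apply_of_ne_of_ne h1 h2]; simp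
  · simp only [Y]
    rw [hsg_sw _ x y hne rfl]
    simp [colProd, hneg]

end converse

theorem diag_exists (f : ℕ → ℕ) (m N : ℕ) (h : ∀ k, N ≤ k → ∑ i ∈ Finset.range k, f i = m) :
    ∃ r c : Fin m → ℕ, (∀ x, c x < f (r x)) ∧ (∀ x y, r x = r y → c x = c y → x = y) ∧
      (∀ i j, j < f i → ∃ x, r x = i ∧ c x = j) ∧
      (∀ i, Nat.card {x // r x = i} = f i) := by
  classical
  have h0 : ∀ i, N ≤ i → f i = 0 := by
    intro i hi
    have h1 := h i hi
    have h2 := h (i+1) (by omega)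
    rw [Finset.sum_range_succ] at h2
    omega
  let cells : Finset (Σ _ : ℕ, ℕ) := (Finset.range N).sigma fun i => Finset.range (f i)
  have hcard : cells.card = m := by
    rw [Finset.card_sigma]; simpa using h N le_rfl
  let e := cells.equivFinOfCardEq hcard
  have hlt : ∀ x, (e.symm x).1.2 < f (e.symm x).1.1 := by
    intro x
    have := (e.symm x).2
    rw [Finset.mem_sigma] at this
    simpa using this.2
  have hinj : ∀ x y, (e.symm x).1.1 = (e.symm y).1.1 → (e.symm x).1.2 = (e.symm y).1.2 →
      x = y := by
    intro x y h1 h2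
    refine e.symm.injective (Subtype.ext (Sigma.ext h1 (heq_of_eq h2)))
  have hsurj : ∀ i j, j < f i → ∃ x, (e.symm x).1.1 = i ∧ (e.symm x).1.2 = j := by
    intro i j hj
    refine ⟨e ⟨⟨i, j⟩, ?_⟩, by simp, by simp⟩
    rw [Finset.mem_sigma]
    simp only [Finset.mem_range]
    refine ⟨?_, hj⟩
    by_contra hi
    have := h0 i (by omega)
    omega
  refine ⟨fun x => (e.symm x).1.1, fun x => (e.symm x).1.2, hlt, hinj, hsurj, fun i => ?_⟩
  rw [← Nat.card_fin (f i)]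
  refine Nat.card_congr (Equiv.ofBijective
    (fun x => (⟨(e.symm x.1).1.2, lt_of_lt_of_eq (hlt x.1) (congrArg f x.2)⟩ : Fin (f i)))
    ⟨fun x y hxy => ?_, fun j => ?_⟩)
  · exact Subtype.ext (hinj _ _ (x.2.trans y.2.symm) (congrArg Fin.val hxy))
  · obtain ⟨x, hx1, hx2⟩ := hsurj i j.1 j.2
    exact ⟨⟨x, hx1⟩, Fin.ext hx2⟩

/-- If no two points of `B` share both a row in the second filling and a column in the first,
then the second shape is dominated by the first. -/
theorem comb_dom {α : Type} [DecidableEq α] (B : Finset α) (r' r c : α → ℕ) (f : ℕ → ℕ)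
    (hf : Antitone f) (hlt : ∀ x ∈ B, c x < f (r x))
    (hsurj : ∀ i j, j < f i → ∃ x ∈ B, r x = i ∧ c x = j)
    (hno : ∀ x ∈ B, ∀ y ∈ B, r' x = r' y → c x = c y → x = y) (k : ℕ) :
    (B.filter fun x => r' x < k).card ≤ (B.filter fun x => r x < k).card := by
  rw [Finset.card_eq_sum_card_fiberwise (f := c) (t := B.image c)
    (fun x hx => Finset.mem_coe.2 (Finset.mem_image_of_mem _ (Finset.mem_filter.1 hx).1)),
    Finset.card_eq_sum_card_fiberwise (f := c) (s := B.filter fun x => r x < k) (t := B.image c)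
    (fun x hx => Finset.mem_coe.2 (Finset.mem_image_of_mem _ (Finset.mem_filter.1 hx).1))]
  refine Finset.sum_le_sum fun j _ => ?_
  by_cases hk : ∃ x ∈ B, c x = j ∧ k ≤ r x
  · obtain ⟨x, hx, hxj, hxk⟩ := hk
    refine le_trans (b := k) ?_ ?_
    · refine le_trans (Finset.card_le_card_of_injOn r' (t := Finset.range k) ?_ ?_)
        (Finset.card_range k).le
      · intro y hy
        simp only [Finset.coe_filter, Finset.mem_filter, Set.mem_ofPred_eq] at hy
        simpa using hy.1.2
      · intro y hy z hz hyz
        simp only [Finset.coe_filter, Finset.mem_filter, Set.mem_ofPred_eq] at hy hz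
        exact hno y hy.1.1 z hz.1.1 hyz (hy.2.trans hz.2.symm)
    · have hsub : Finset.range k ⊆
          (((B.filter fun x => r x < k).filter fun x => c x = j).image r) := by
        intro i hi
        have hi := Finset.mem_range.1 hi
        obtain ⟨y, hy, hy1, hy2⟩ := hsurj i j
          (lt_of_lt_of_le (hxj ▸ hlt x hx) (hf (by omega)))
        simp only [Finset.mem_image, Finset.mem_filter]
        exact ⟨y, ⟨⟨hy, by omega⟩, hy2⟩, hy1⟩
      have := Finset.card_le_card hsub
      rw [Finset.card_range] at this
      exact this.trans Finset.card_image_le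
  · push Not at hk
    refine Finset.card_le_card fun x hx => ?_
    simp only [Finset.mem_filter] at hx ⊢
    exact ⟨⟨hx.1.1, hk x hx.1.1 hx.2⟩, hx.2⟩

theorem count_below {n : ℕ} (ι : ℕ → ℕ ⊕ ℕ) (hι : ∀ i, Sum.elim id id (ι i) = i)
    (A : Fin n → ℕ ⊕ ℕ) (B : Finset (Fin n)) (hB : ∀ x, x ∈ B ↔ ∃ i, A x = ι i)
    (s : ℕ → ℕ) (hs : ∀ i, Nat.card {x // A x = ι i} = s i) (k : ℕ) :
    (B.filter fun x => Sum.elim id id (A x) < k).card = ∑ i ∈ Finset.range k, s i := by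
  classical
  rw [Finset.card_eq_sum_card_fiberwise (f := fun x => Sum.elim id id (A x))
    (t := Finset.range k) (fun x hx => by simpa using (Finset.mem_filter.1 hx).2)]
  refine Finset.sum_congr rfl fun i hi => ?_
  rw [← hs i, Nat.card_eq_fintype_card, Fintype.card_subtype]
  congr 1
  ext x
  simp only [Finset.mem_filter, hB, Finset.mem_univ, true_and]
  constructor
  · rintro ⟨⟨⟨j, hj⟩, h1⟩, h2⟩
    rw [hj, hι] at h2
    rw [hj, h2]
  · intro h
    have := Finset.mem_range.1 hi
    exact ⟨⟨⟨i, h⟩, by rw [h, hι]; exact this⟩, by rw [h, hι]⟩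

theorem side_dom {n : ℕ} (ι : ℕ → ℕ ⊕ ℕ) (hι : ∀ i, Sum.elim id id (ι i) = i)
    (A T : Fin n → ℕ ⊕ ℕ) (col : Fin n → ℕ) (hAT : ∀ x, (∃ i, A x = ι i) ↔ ∃ i, T x = ι i)
    (s f : ℕ → ℕ) (hs : ∀ i, Nat.card {x // A x = ι i} = s i)
    (hf : ∀ i, Nat.card {x // T x = ι i} = f i) (hanti : Antitone f)
    (hlt : ∀ x i, T x = ι i → col x < f i)
    (hsurj : ∀ i j, j < f i → ∃ x, T x = ι i ∧ col x = j)
    (hno : ∀ x y, A x = A y → col x = col y → x = y) (k : ℕ) :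
    ∑ i ∈ Finset.range k, s i ≤ ∑ i ∈ Finset.range k, f i := by
  classical
  let B : Finset (Fin n) := Finset.univ.filter fun x => ∃ i, A x = ι i
  have hB : ∀ x, x ∈ B ↔ ∃ i, A x = ι i := fun x => by simp [B]
  have hB' : ∀ x, x ∈ B ↔ ∃ i, T x = ι i := fun x => (hB x).trans (hAT x)
  rw [← count_below ι hι A B hB s hs k, ← count_below ι hι T B hB' f hf k]
  refine comb_dom B _ _ col f hanti ?_ ?_ ?_ k
  · intro x hx
    obtain ⟨i, hi⟩ := (hB' x).1 hx
    rw [hi, hι]; exact hlt x i hi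
  · intro i j hj
    obtain ⟨x, h1, h2⟩ := hsurj i j hj
    exact ⟨x, (hB' x).2 ⟨i, h1⟩, by rw [h1, hι], h2⟩
  · intro x hx y hy h1 h2
    obtain ⟨i, hi⟩ := (hB x).1 hx
    obtain ⟨j, hj⟩ := (hB y).1 hy
    rw [hi, hj, hι, hι] at h1
    exact hno x y (by rw [hi, hj, h1]) h2

theorem left_count {n : ℕ} (A : Fin n → ℕ ⊕ ℕ) (σ : Multiset ℕ)
    (hs : ∀ i, Nat.card {x // A x = Sum.inl i} = dparts σ i) :
    (Finset.univ.filter fun x => (A x).isLeft = true).card = σ.sum := by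
  classical
  obtain ⟨N, hN⟩ := dparts_total σ
  rw [← hN N le_rfl, ← count_below Sum.inl (fun _ => rfl) A
    (Finset.univ.filter fun x => (A x).isLeft = true)
    (fun x => by simp [Sum.isLeft_iff]) (dparts σ) hs N]
  congr 1
  symm
  rw [Finset.filter_eq_self]
  intro x hx
  obtain ⟨i, hi⟩ := Sum.isLeft_iff.1 (Finset.mem_filter.1 hx).2
  rw [hi]
  change i < N
  by_contra h
  have h1 := hN i (by omega)
  have h2 := hN (i+1) (by omega)
  rw [Finset.sum_range_succ] at h2
  have h3 : Nat.card {x // A x = Sum.inl i} = 0 := by rw [hs i]; omega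
  haveI : Nonempty {x // A x = Sum.inl i} := ⟨⟨x, hi⟩⟩
  have : 0 < Nat.card {x // A x = Sum.inl i} := Nat.card_pos
  omega

theorem card_glue {n a b : ℕ} (e : Fin n ≃ Fin a ⊕ Fin b) (r1 : Fin a → ℕ) (r2 : Fin b → ℕ)
    (i : ℕ) : Nat.card {x // Sum.map r1 r2 (e x) = Sum.inl i} = Nat.card {x // r1 x = i} ∧
      Nat.card {x // Sum.map r1 r2 (e x) = Sum.inr i} = Nat.card {x // r2 x = i} := by
  constructor
  · refine (Nat.card_congr (Equiv.ofBijective (fun x : {x // r1 x = i} =>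
      (⟨e.symm (Sum.inl x.1), by simp [x.2]⟩ : {x // Sum.map r1 r2 (e x) = Sum.inl i}))
      ⟨fun x y h => ?_, fun y => ?_⟩)).symm
    · have := congrArg Subtype.val h
      exact Subtype.ext (Sum.inl_injective (e.symm.injective this))
    · obtain ⟨y, hy⟩ := y
      cases h : e y with
      | inl z =>
        rw [h] at hy
        exact ⟨⟨z, by simpa using hy⟩, Subtype.ext (by simp [← h])⟩
      | inr z => rw [h] at hy; simp at hy
  · refine (Nat.card_congr (Equiv.ofBijective (fun x : {x // r2 x = i} =>
      (⟨e.symm (Sum.inr x.1), by simp [x.2]⟩ : {x // Sum.map r1 r2 (e x) = Sum.inr i}))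
      ⟨fun x y h => ?_, fun y => ?_⟩)).symm
    · have := congrArg Subtype.val h
      exact Subtype.ext (Sum.inr_injective (e.symm.injective this))
    · obtain ⟨y, hy⟩ := y
      cases h : e y with
      | inr z =>
        rw [h] at hy
        exact ⟨⟨z, by simpa using hy⟩, Subtype.ext (by simp [← h])⟩
      | inl z => rw [h] at hy; simp at hy

theorem dom_converse (G : Type) [CommGroup G] [Fintype G] [Nontrivial G] (n : ℕ)
    (σ ρ τ π : Multiset ℕ) (hn1 : σ.sum + ρ.sum = n)
    (h1 : σ.sum = τ.sum) (h2 : ρ.sum = π.sum) (hdom : DPDom G n σ ρ τ π) :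
    msDom σ τ ∧ msDom ρ π := by
  classical
  by_contra hcon
  obtain ⟨Nσ, hNσ⟩ := dparts_total σ
  obtain ⟨Nρ, hNρ⟩ := dparts_total ρ
  obtain ⟨Nτ, hNτ⟩ := dparts_total τ
  obtain ⟨Nπ, hNπ⟩ := dparts_total π
  rw [← h1] at hNτ
  rw [← h2] at hNπ
  obtain ⟨rσ, -, -, -, -, kσ⟩ := diag_exists _ _ _ hNσ
  obtain ⟨rρ, -, -, -, -, kρ⟩ := diag_exists _ _ _ hNρ
  obtain ⟨rτ, cτ, lτ, iτ, sτ, kτ⟩ := diag_exists _ _ _ hNτ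
  obtain ⟨rπ, cπ, lπ, iπ, sπ, kπ⟩ := diag_exists _ _ _ hNπ
  let e : Fin n ≃ Fin σ.sum ⊕ Fin ρ.sum := (finCongr hn1.symm).trans finSumFinEquiv.symm
  let T : Fin n → ℕ ⊕ ℕ := fun x => Sum.map rτ rπ (e x)
  let col : Fin n → ℕ := fun x => Sum.elim cτ cπ (e x)
  let A0 : Fin n → ℕ ⊕ ℕ := fun x => Sum.map rσ rρ (e x)
  have hT : IsTab G n (Sum.elim (dparts τ) (dparts π)) (T, 1) := by
    refine ⟨fun b => ?_, fun _ _ _ => rfl⟩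
    cases b with
    | inl i => exact ((card_glue e rτ rπ i).1).trans (kτ i)
    | inr i => exact ((card_glue e rτ rπ i).2).trans (kπ i)
  have hA0 : IsTab G n (Sum.elim (dparts σ) (dparts ρ)) (A0, 1) := by
    refine ⟨fun b => ?_, fun _ _ _ => rfl⟩
    cases b with
    | inl i => exact ((card_glue e rσ rρ i).1).trans (kσ i)
    | inr i => exact ((card_glue e rσ rρ i).2).trans (kρ i)
  have hA0side : ∀ z, (A0 z).isLeft = (T z).isLeft := by
    intro z
    simp only [A0, T, Sum.isLeft_map]
  have hinj : ∀ x y, T x = T y → col x = col y → x = y := by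
    intro x y hx hc
    apply e.injective
    simp only [T, col] at hx hc
    cases h3 : e x with
    | inl u =>
      cases h4 : e y with
      | inl v =>
        rw [h3, h4] at hx hc
        exact congrArg Sum.inl (iτ u v (by simpa using hx) hc)
      | inr v => rw [h3, h4] at hx; simp at hx
    | inr u =>
      cases h4 : e y with
      | inl v => rw [h3, h4] at hx; simp at hx
      | inr v =>
        rw [h3, h4] at hx hc
        exact congrArg Sum.inr (iπ u v (by simpa using hx) hc)
  have hcore : ∀ A f, IsTab G n (Sum.elim (dparts σ) (dparts ρ)) (A, f) →
      (∀ z, (A z).isLeft = (T z).isLeft) →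
      ∃ x y, x ≠ y ∧ A x = A y ∧ col x = col y := by
    intro A f hA hside
    by_contra hno
    have hno : ∀ x y, A x = A y → col x = col y → x = y := by
      intro x y ha hb
      by_contra hxy
      exact hno ⟨x, y, hxy, ha, hb⟩
    refine hcon ⟨fun k => ?_, fun k => ?_⟩
    · rw [dparts_eq, dparts_eq]
      refine side_dom Sum.inl (fun _ => rfl) A T col ?_ _ _ (fun i => hA.1 (Sum.inl i))
        (fun i => hT.1 (Sum.inl i)) (dparts_antitone τ) ?_ ?_ hno k
      · intro x
        rw [← Sum.isLeft_iff, ← Sum.isLeft_iff, hside]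
      · intro x i hx
        simp only [T, col] at hx ⊢
        cases h3 : e x with
        | inl u =>
          rw [h3] at hx
          have := lτ u
          rw [show rτ u = i by simpa using hx] at this
          exact this
        | inr u => rw [h3] at hx; simp at hx
      · intro i j hj
        obtain ⟨u, hu1, hu2⟩ := sτ i j hj
        exact ⟨e.symm (Sum.inl u), by simp [T, hu1], by simp [col, hu2]⟩
    · rw [dparts_eq, dparts_eq]
      refine side_dom Sum.inr (fun _ => rfl) A T col ?_ _ _ (fun i => hA.1 (Sum.inr i))
        (fun i => hT.1 (Sum.inr i)) (dparts_antitone π) ?_ ?_ hno k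
      · intro x
        rw [← Sum.isRight_iff, ← Sum.isRight_iff]
        have := hside x
        cases h3 : A x <;> cases h4 : T x <;> simp_all
      · intro x i hx
        simp only [T, col] at hx ⊢
        cases h3 : e x with
        | inr u =>
          rw [h3] at hx
          have := lπ u
          rw [show rπ u = i by simpa using hx] at this
          exact this
        | inl u => rw [h3] at hx; simp at hx
      · intro i j hj
        obtain ⟨u, hu1, hu2⟩ := sπ i j hj
        exact ⟨e.symm (Sum.inr u), by simp [T, hu1], by simp [col, hu2]⟩
  obtain ⟨x0, y0, hne0, hA00, hcol0⟩ := hcore A0 1 hA0 hA0side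
  refine not_dom (G := G) (Sum.elim (dparts σ) (dparts ρ)) (Sum.elim (dparts τ) (dparts π))
    T col hT hinj ?_ ⟨A0 x0, ?_⟩ ⟨x0, y0, hne0, hcol0, ?_⟩ ⟨_, hA0⟩ ?_
  · intro A f hA
    by_cases hex : ∃ x, (T x).isLeft = true ∧ (A x).isLeft = false
    · exact Or.inl hex
    · right
      have hsub : (Finset.univ.filter fun x => (T x).isLeft = true) ⊆
          (Finset.univ.filter fun x => (A x).isLeft = true) := by
        intro x hx
        simp only [Finset.mem_filter, Finset.mem_univ, true_and] at hx ⊢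
        by_contra h
        exact hex ⟨x, hx, by simpa using h⟩
      have heq := Finset.eq_of_subset_of_card_le hsub (by
        rw [left_count A σ fun i => hA.1 (Sum.inl i), left_count T τ fun i => hT.1 (Sum.inl i), h1])
      have hside : ∀ z, (A z).isLeft = (T z).isLeft := by
        intro z
        have := Finset.ext_iff.1 heq z
        simp only [Finset.mem_filter, Finset.mem_univ, true_and] at this
        rw [Bool.eq_iff_iff]
        exact this.symm
      obtain ⟨x, y, p1, p2, p3⟩ := hcore A f hA hside
      exact ⟨x, y, p1, p2, p3, hside⟩
  · rw [← hA0.1 (A0 x0)]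
    refine Finite.one_lt_card_iff_nontrivial.2 ⟨⟨x0, rfl⟩, ⟨y0, hA00.symm⟩, fun h => hne0 ?_⟩
    exact congrArg Subtype.val h
  · rw [← hA0side, ← hA0side, hA00]
  · intro Y hY
    have hconv : ∀ α β : Multiset ℕ, {T | IsTabloid G n α β T} =
        {T | IsTab G n (Sum.elim (dparts α) (dparts β)) T} := fun α β =>
      Set.ext fun T => isTabloid_iff G n α β T
    rw [← hconv] at hY ⊢
    exact hdom Y hY


/-- **Characterisation of `≽` for double partitions with `|σ| = |τ|`.**
Let `G` be a nontrivial finite abelian group and let `(σ,ρ)` and `(τ,π)` be double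
partitions of `n ≥ 1` with `|σ| = |τ|`.  Then `(σ,ρ) ≽_G (τ,π)` (every
`(σ,ρ)`-transitive subset of `G ≀ Sₙ` is `(τ,π)`-transitive) if and only if
`σ ⊴ τ` and `ρ ⊴ π`. -/
theorem dom_characterisation_equal_sizes (G : Type) [CommGroup G] [Fintype G] [Nontrivial G]
    (n : ℕ) (hn : 1 ≤ n) (σ ρ τ π : Multiset ℕ)
    (hσ0 : 0 ∉ σ) (hρ0 : 0 ∉ ρ) (hτ0 : 0 ∉ τ) (hπ0 : 0 ∉ π)
    (hn1 : σ.sum + ρ.sum = n) (hn2 : τ.sum + π.sum = n)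
    (hsize : σ.sum = τ.sum) :
    DPDom G n σ ρ τ π ↔ (msDom σ τ ∧ msDom ρ π) := by
  have h2 : ρ.sum = π.sum := by omega
  exact ⟨fun h => dom_converse G n σ ρ τ π hn1 hsize h2 h,
    fun h => dom_forward G n σ ρ τ π hsize h2 h.1 h.2⟩
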